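/- Let A ∈ ℝ^{m×n} with m ≥ n ≥ 2, let B̄ ∈ ℝ^{k×n} be obtained from A by deleting a subset of the rows of A, set j = ⌈n/(8·log₂(8m/n))⌉ and assume j ≤ min{k, n}. Let W ∈ ℝ^{j×n} be a matrix whose rows are orthonormal eigenvectors of B̄ᵀB̄ corresponding to its j largest eigenvalues. Then fewer than k/2 rows of B̄(I − WᵀW) have Euclidean norm exceeding 48e·log₂(8m/n)·herdisc(A). -/

import Mathlib

open Matrix

noncomputable def disc {I J : Type*} [Fintype I] [Fintype J] (A : Matrix I J ℝ) : ℝ :=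
  sInf {d : ℝ | ∃ x : J → ℝ, (∀ j, x j = 1 ∨ x j = -1) ∧ d = ⨆ i, |A.mulVec x i|}

noncomputable def herdisc {m n : ℕ} (A : Matrix (Fin m) (Fin n) ℝ) : ℝ :=
  sSup {d : ℝ | ∃ S : Finset (Fin n),
    d = disc (A.submatrix id (fun j : {j // j ∈ S} => (j : Fin n)))}

/-- Every set of columns of `A` has a signing of discrepancy at most `h`. -/
def HasHerdiscLE {I J : Type*} [Fintype J] (A : Matrix I J ℝ) (h : ℝ) : Prop :=
  ∀ S : Finset J, ∃ x : J → ℝ, (∀ c ∈ S, x c = 1 ∨ x c = -1) ∧ (∀ c ∉ S, x c = 0) ∧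
    ∀ i, |A.mulVec x i| ≤ h

theorem disc_nonneg {I J : Type*} [Fintype I] [Fintype J] (A : Matrix I J ℝ) : 0 ≤ disc A := by
  apply Real.sInf_nonneg
  rintro _ ⟨x, -, rfl⟩
  exact Real.iSup_nonneg fun i => abs_nonneg _

theorem herdisc_nonneg {m n : ℕ} (A : Matrix (Fin m) (Fin n) ℝ) : 0 ≤ herdisc A := by
  apply Real.sSup_nonneg
  rintro _ ⟨S, rfl⟩
  exact disc_nonneg _

theorem exists_signing_le_disc {I J : Type*} [Fintype I] [Fintype J] (A : Matrix I J ℝ) :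
    ∃ x : J → ℝ, (∀ j, x j = 1 ∨ x j = -1) ∧ ∀ i, |A.mulVec x i| ≤ disc A := by
  classical
  have hfin : {d : ℝ | ∃ x : J → ℝ, (∀ j, x j = 1 ∨ x j = -1) ∧
      d = ⨆ i, |A.mulVec x i|}.Finite := by
    have hx : {x : J → ℝ | ∀ j, x j = 1 ∨ x j = -1}.Finite := by
      have := Set.Finite.pi' (fun _ : J => Set.toFinite ({1, -1} : Set ℝ))
      exact this.subset fun x hx j => by simpa using hx j
    refine (hx.image fun x => ⨆ i, |A.mulVec x i|).subset ?_
    rintro _ ⟨x, h, rfl⟩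
    exact ⟨x, h, rfl⟩
  obtain ⟨x, hx, hd⟩ := Set.Nonempty.csInf_mem (by exact ⟨_, 1, fun _ => Or.inl rfl, rfl⟩) hfin
  refine ⟨x, hx, fun i => ?_⟩
  rw [disc, hd]
  exact le_ciSup (f := fun i => |A.mulVec x i|) (Set.finite_range _).bddAbove i

theorem hasHerdiscLE_herdisc {m n : ℕ} (A : Matrix (Fin m) (Fin n) ℝ) :
    HasHerdiscLE A (herdisc A) := by
  intro S
  obtain ⟨x, hx, hd⟩ :=
    exists_signing_le_disc (A.submatrix id (fun j : {j // j ∈ S} => (j : Fin n)))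
  refine ⟨fun c => if hc : c ∈ S then x ⟨c, hc⟩ else 0, fun c hc => ?_, fun c hc => ?_,
    fun i => ?_⟩
  · simpa [hc] using hx ⟨c, hc⟩
  · simp [hc]
  · have h1 : disc (A.submatrix id (fun j : {j // j ∈ S} => (j : Fin n))) ≤ herdisc A := by
      refine le_csSup ((Set.finite_range fun S : Finset (Fin n) =>
        disc (A.submatrix id (fun j : {j // j ∈ S} => (j : Fin n)))).subset ?_).bddAbove ⟨S, rfl⟩
      rintro _ ⟨S, rfl⟩
      exact ⟨S, rfl⟩
    refine le_trans (le_of_eq ?_) ((hd i).trans h1)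
    congr 1
    simp only [Matrix.mulVec, dotProduct, Matrix.submatrix_apply, id]
    rw [← Finset.sum_subset (Finset.subset_univ S) (fun c _ hc => by simp [hc]),
      ← Finset.sum_coe_sort]
    exact Finset.sum_congr rfl fun c _ => by simp

theorem HasHerdiscLE.submatrix {I J I' J' : Type*} [Fintype J] [Fintype J'] {A : Matrix I J ℝ}
    {h : ℝ} (hA : HasHerdiscLE A h) (f : I' → I) {g : J' → J} (hg : g.Injective) :
    HasHerdiscLE (A.submatrix f g) h := by
  classical
  intro S
  obtain ⟨x, h1, h2, h3⟩ := hA (S.map ⟨g, hg⟩)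
  refine ⟨x ∘ g, fun c hc => h1 _ (by simpa [hg.eq_iff] using hc),
    fun c hc => h2 _ (by simpa [hg.eq_iff] using hc), fun i => ?_⟩
  refine le_trans (le_of_eq ?_) (h3 (f i))
  congr 1
  simp only [Matrix.mulVec, dotProduct, Matrix.submatrix_apply, Function.comp]
  rw [← Finset.sum_subset (Finset.subset_univ (Finset.univ.map ⟨g, hg⟩)), Finset.sum_map]
  · rfl
  · intro c _ hc
    rw [h2 c fun hc' => hc (Finset.map_subset_map.2 (Finset.subset_univ S) hc'), mul_zero]

/-- Rounding the entries of a vector in the unit cube costs at most the hereditary discrepancy. -/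
theorem HasHerdiscLE.exists_rounding {I J : Type*} [Fintype I] [Fintype J] {A : Matrix I J ℝ}
    {h : ℝ} (hA : HasHerdiscLE A h) (w : J → ℝ) (hw : ∀ c, 0 ≤ w c ∧ w c ≤ 1) :
    ∃ x : J → ℝ, (∀ c, x c = 0 ∨ x c = 1) ∧ ∀ i, |A.mulVec (w - x) i| ≤ h := by
  classical
  obtain ⟨C, hC⟩ : ∃ C : ℝ, ∀ i, ∑ c, |A i c| ≤ C :=
    ⟨∑ i, ∑ c, |A i c|, fun i => Finset.single_le_sum (f := fun i => ∑ c, |A i c|)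
      (fun i _ => Finset.sum_nonneg fun c _ => abs_nonneg _) (Finset.mem_univ i)⟩
  have approx : ∀ d : ℕ, ∀ w : J → ℝ, (∀ c, 0 ≤ w c ∧ w c ≤ 1) →
      ∃ x : J → ℝ, (∀ c, x c = 0 ∨ x c = 1) ∧
        ∀ i, |A.mulVec (w - x) i| ≤ h + (C + |h|) / 2 ^ d := by
    intro d
    induction d with
    | zero =>
      intro w hw
      refine ⟨0, fun c => Or.inl rfl, fun i => ?_⟩
      have : |A.mulVec (w - 0) i| ≤ ∑ c, |A i c| := by
        refine (Finset.abs_sum_le_sum_abs _ _).trans (Finset.sum_le_sum fun c _ => ?_)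
        rw [abs_mul, sub_zero, abs_of_nonneg (hw c).1]
        exact mul_le_of_le_one_right (abs_nonneg _) (hw c).2
      have h2 := hC i
      have h3 := neg_abs_le h
      simp only [pow_zero, div_one]
      linarith
    | succ d ih =>
      intro w hw
      obtain ⟨u, hu, hub⟩ := ih (fun c => if w c ≤ 1 / 2 then 2 * w c else 2 * w c - 1)
        fun c => by have := hw c; split_ifs <;> constructor <;> linarith
      set v : J → ℝ := fun c => if w c ≤ 1 / 2 then 2 * w c else 2 * w c - 1 with hv
      let a : J → ℝ := fun c => if w c ≤ 1 / 2 then 0 else 1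
      obtain ⟨y, hy1, hy2, hy3⟩ := hA (Finset.univ.filter fun c => a c ≠ u c)
      refine ⟨fun c => (a c + u c + y c) / 2, fun c => ?_, fun i => ?_⟩
      · have ha : a c = 0 ∨ a c = 1 := by
          by_cases hc : w c ≤ 1 / 2
          · exact Or.inl (if_pos hc)
          · exact Or.inr (if_neg hc)
        by_cases hc : a c = u c
        · have := hy2 c (by simpa using hc)
          rcases ha with h' | h' <;> simp [← hc, h', this]
        · rcases ha with h' | h' <;> rcases hu c with h'' | h'' <;>
            rcases hy1 c (by simpa using hc) with h | h <;> simp_all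
      · have hdec : w - (fun c => (a c + u c + y c) / 2) =
            (1 / 2 : ℝ) • (v - u) - (1 / 2 : ℝ) • y := by
          funext c
          simp only [a, hv, Pi.sub_apply, Pi.smul_apply, smul_eq_mul]
          split_ifs <;> ring
        rw [hdec, Matrix.mulVec_sub, Matrix.mulVec_smul, Matrix.mulVec_smul]
        have e1 := hub i
        have e2 := hy3 i
        simp only [Pi.sub_apply, Pi.smul_apply, smul_eq_mul]
        have e3 : (C + |h|) / 2 ^ (d + 1) = (C + |h|) / 2 ^ d / 2 := by
          rw [pow_succ]; field_simp
        rw [e3]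
        rw [abs_le] at e1 e2 ⊢
        constructor <;> linarith
  by_contra! hcon
  have hfin : {x : J → ℝ | ∀ c, x c = 0 ∨ x c = 1}.Finite := by
    have := Set.Finite.pi' (fun _ : J => Set.toFinite ({0, 1} : Set ℝ))
    exact this.subset fun x hx j => by simpa using hx j
  have : Nonempty I := ⟨(hcon 0 fun _ => Or.inl rfl).choose⟩
  choose! r hr using hcon
  obtain ⟨x₀, hx₀, hmin⟩ := Set.exists_min_image _ (fun x => |A.mulVec (w - x) (r x)|) hfin
    ⟨0, fun _ => Or.inl rfl⟩
  have hlim : Filter.Tendsto (fun d : ℕ => h + (C + |h|) / 2 ^ d) Filter.atTop (nhds h) := by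
    have h0 : Filter.Tendsto (fun d : ℕ => (C + |h|) / (2 : ℝ) ^ d) Filter.atTop (nhds 0) :=
      Filter.Tendsto.div_atTop tendsto_const_nhds
        (tendsto_pow_atTop_atTop_of_one_lt (by norm_num))
    simpa using h0.const_add h
  obtain ⟨d, hd⟩ := (hlim.eventually_lt_const (hr x₀ hx₀)).exists
  obtain ⟨x, hx, hxb⟩ := approx d w hw
  exact absurd (hmin x hx) (not_le.2 ((hxb _).trans_lt hd))

open MeasureTheory in
/-- The determinant lower bound of Lovász, Spencer and Vesztergombi. -/
theorem HasHerdiscLE.abs_det_le {ι : Type*} [Fintype ι] [DecidableEq ι] {B : Matrix ι ι ℝ}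
    {h : ℝ} (hB : HasHerdiscLE B h) (h0 : 0 ≤ h) : |B.det| ≤ (2 * h) ^ Fintype.card ι := by
  by_cases hdet : B.det = 0
  · rw [hdet, abs_zero]; positivity
  let Q : Set (ι → ℝ) := Set.univ.pi fun _ => Set.Ico 0 1
  let R : Set (ι → ℝ) := Set.Icc (fun _ => -h) (fun _ => h)
  let K : Set (ι → ℝ) := Matrix.toLin' B ⁻¹' R
  let v : (ι → ℤ) → ι → ℝ := fun z i => z i
  have hQm : MeasurableSet Q := MeasurableSet.univ_pi fun _ => measurableSet_Ico
  have hLm : Measurable (Matrix.toLin' B) :=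
    (LinearMap.continuous_of_finiteDimensional _).measurable
  have hKm : MeasurableSet K := hLm measurableSet_Icc
  have hQ : volume Q = 1 := by simp [Q, Real.volume_pi_Ico]
  have hK : volume K = ENNReal.ofReal |B.det⁻¹| * ENNReal.ofReal (2 * h) ^ Fintype.card ι := by
    rw [← Measure.map_apply hLm measurableSet_Icc,
      Real.map_matrix_volume_pi_eq_smul_volume_pi hdet]
    simp [Real.volume_Icc_pi, two_mul]
  have hcover : Q ⊆ ⋃ z, Q ∩ (fun w => w + -v z) ⁻¹' K := by
    intro w hw
    obtain ⟨x, hx, hxb⟩ := hB.exists_rounding w fun c =>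
      ⟨(hw c trivial).1, (hw c trivial).2.le⟩
    have hz : ∃ z : ι → ℤ, v z = x := by
      refine ⟨fun i => if x i = 0 then 0 else 1, ?_⟩
      funext i
      rcases hx i with h | h <;> simp [v, h]
    obtain ⟨z, rfl⟩ := hz
    refine Set.mem_iUnion.2 ⟨z, hw, ?_⟩
    simp only [Set.mem_preimage, K, R, Set.mem_Icc, Pi.le_def, Matrix.toLin'_apply,
      ← sub_eq_add_neg]
    exact ⟨fun i => (abs_le.1 (hxb i)).1, fun i => (abs_le.1 (hxb i)).2⟩
  have htrans : ∀ z, volume (Q ∩ (fun w => w + -v z) ⁻¹' K) =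
      volume ((fun w => w + v z) ⁻¹' Q ∩ K) := by
    intro z
    rw [← measure_preimage_add_right volume (v z)]
    congr 1
    ext w
    simp
  have hdisj : Pairwise fun z z' => Disjoint ((fun w => w + v z) ⁻¹' Q ∩ K)
      ((fun w => w + v z') ⁻¹' Q ∩ K) := by
    intro z z' hzz
    refine Set.disjoint_left.2 fun w hw hw' => hzz (funext fun i => ?_)
    have e1 := hw.1 i trivial
    have e2 := hw'.1 i trivial
    simp only [v, Pi.add_apply, Set.mem_Ico] at e1 e2
    have l1 : (z i : ℝ) < z' i + 1 := by linarith
    have l2 : (z' i : ℝ) < z i + 1 := by linarith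
    norm_cast at l1 l2
    omega
  have hone : 1 ≤ volume K := calc
    1 = volume Q := hQ.symm
    _ ≤ ∑' z, volume (Q ∩ (fun w => w + -v z) ⁻¹' K) :=
      (measure_mono hcover).trans (measure_iUnion_le _)
    _ = volume (⋃ z, (fun w => w + v z) ⁻¹' Q ∩ K) := by
      rw [measure_iUnion hdisj fun z => ((measurable_add_const (v z)) hQm).inter hKm]
      exact tsum_congr htrans
    _ ≤ volume K := measure_mono (Set.iUnion_subset fun z => Set.inter_subset_right)
  rw [hK, ← ENNReal.ofReal_pow (by positivity), ← ENNReal.ofReal_mul (abs_nonneg _),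
    ENNReal.one_le_ofReal, abs_inv, inv_mul_eq_div, one_le_div (abs_pos.2 hdet)] at hone
  exact hone

/-- The Cauchy–Binet formula, summed over all maps instead of all subsets. -/
theorem sum_det_submatrix_mul_det_submatrix {ι κ : Type*} [Fintype ι] [DecidableEq ι] [Fintype κ]
    (M : Matrix ι κ ℝ) (N : Matrix κ ι ℝ) :
    ∑ f : ι → κ, (M.submatrix id f).det * (N.submatrix f id).det =
      (Fintype.card ι).factorial * (M * N).det := by
  classical
  have hexp : ∑ f : ι → κ, (∏ i, M i (f i)) * (N.submatrix f id).det = (M * N).det := by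
    have h1 : M * N = fun i => ∑ c, M i c • N c := by
      funext i l
      simp [Matrix.mul_apply]
    rw [h1]
    have h2 := (Matrix.detRowAlternating (R := ℝ) (n := ι)).toMultilinearMap.map_sum
      (fun (i : ι) (c : κ) => M i c • N c)
    refine Eq.trans ?_ h2.symm
    refine Finset.sum_congr rfl fun f _ => ?_
    have h3 := (Matrix.detRowAlternating (R := ℝ) (n := ι)).toMultilinearMap.map_smul_univ
      (fun i => M i (f i)) (fun i => N (f i))
    exact h3.symm
  have hperm : ∀ σ : Equiv.Perm ι, ∑ f : ι → κ, (Equiv.Perm.sign σ : ℝ) *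
      (∏ i, M i (f (σ i))) * (N.submatrix f id).det = (M * N).det := by
    intro σ
    rw [← hexp, ← Equiv.sum_comp (σ.arrowCongr (Equiv.refl κ))]
    refine Finset.sum_congr rfl fun f _ => ?_
    have h1 : (N.submatrix (σ.arrowCongr (Equiv.refl κ) f) id).det =
        Equiv.Perm.sign σ * (N.submatrix f id).det := by
      have := Matrix.det_permute σ.symm (N.submatrix f id)
      rw [Equiv.Perm.sign_symm] at this
      exact this
    have h2 : (Equiv.Perm.sign σ : ℝ) * Equiv.Perm.sign σ = 1 := by
      rcases Int.units_eq_one_or (Equiv.Perm.sign σ) with h | h <;> simp [h]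
    rw [h1]
    simp only [Equiv.arrowCongr_apply, Function.comp, Equiv.symm_apply_apply, Equiv.refl_apply]
    linear_combination (∏ i, M i (f i)) * (N.submatrix f id).det * h2
  calc ∑ f : ι → κ, (M.submatrix id f).det * (N.submatrix f id).det
      = ∑ f : ι → κ, ∑ σ : Equiv.Perm ι, (Equiv.Perm.sign σ : ℝ) *
          (∏ i, M i (f (σ i))) * (N.submatrix f id).det := by
        refine Finset.sum_congr rfl fun f _ => ?_
        rw [← Matrix.det_transpose, Matrix.det_apply', Finset.sum_mul]
        rfl
    _ = (Fintype.card ι).factorial * (M * N).det := by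
        rw [Finset.sum_comm, Finset.sum_congr rfl fun σ _ => hperm σ]
        simp [Fintype.card_perm]

theorem HasHerdiscLE.sq_det_submatrix_le {ι I J : Type*} [Fintype ι] [DecidableEq ι] [Fintype J]
    {B : Matrix I J ℝ} {h : ℝ} (hB : HasHerdiscLE B h) (h0 : 0 ≤ h) (f : ι → I) (g : ι → J) :
    (B.submatrix f g).det ^ 2 ≤ ((2 * h) ^ 2) ^ Fintype.card ι := by
  by_cases hg : g.Injective
  · rw [pow_right_comm, ← sq_abs]
    exact pow_le_pow_left₀ (abs_nonneg _) ((hB.submatrix f hg).abs_det_le h0) 2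
  · obtain ⟨a, b, hab, hne⟩ : ∃ a b, g a = g b ∧ a ≠ b := by
      simpa [Function.Injective] using hg
    rw [Matrix.det_zero_of_column_eq hne fun i => by simp [hab], zero_pow two_ne_zero]
    positivity

/-- The determinant of a compression of the Gram matrix is controlled by the hereditary
discrepancy. -/
theorem HasHerdiscLE.det_compression_le {ι I J : Type*} [Fintype ι] [DecidableEq ι] [Fintype I]
    [Fintype J] {B : Matrix I J ℝ} {h : ℝ} (hB : HasHerdiscLE B h) (h0 : 0 ≤ h)
    (W : Matrix ι J ℝ) (hW : W * Wᵀ = 1) :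
    ((Fintype.card ι).factorial : ℝ) ^ 2 * (W * (Bᵀ * B) * Wᵀ).det ≤
      (Fintype.card I * Fintype.card J * (2 * h) ^ 2) ^ Fintype.card ι := by
  classical
  set F : ℝ := ((Fintype.card ι).factorial : ℝ) with hF
  have hFpos : 0 < F := by positivity
  have hrow : ∀ f : ι → I, F * ((B * Wᵀ).submatrix f id).det ^ 2 ≤
      ∑ g : ι → J, (B.submatrix f g).det ^ 2 := by
    intro f
    have e1 := sum_det_submatrix_mul_det_submatrix (B.submatrix f id) Wᵀ
    have e2 := sum_det_submatrix_mul_det_submatrix W Wᵀ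
    have e3 := Finset.sum_mul_sq_le_sq_mul_sq Finset.univ
      (fun g : ι → J => (B.submatrix f g).det) (fun g => (Wᵀ.submatrix g id).det)
    have e4 : ∑ g : ι → J, (Wᵀ.submatrix g id).det ^ 2 = F := by
      rw [hW, Matrix.det_one, mul_one] at e2
      rw [hF, ← e2]
      refine Finset.sum_congr rfl fun g _ => ?_
      rw [sq, ← Matrix.det_transpose]
      rfl
    rw [e4] at e3
    have e5 : ∑ g : ι → J, (B.submatrix f g).det * (Wᵀ.submatrix g id).det =
        F * ((B * Wᵀ).submatrix f id).det := e1
    rw [e5] at e3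
    nlinarith
  have e1 := sum_det_submatrix_mul_det_submatrix (B * Wᵀ)ᵀ (B * Wᵀ)
  have e2 : (B * Wᵀ)ᵀ * (B * Wᵀ) = W * (Bᵀ * B) * Wᵀ := by
    simp [Matrix.transpose_mul, Matrix.mul_assoc]
  rw [e2, ← hF] at e1
  have e3 : ∑ f : ι → I, ((B * Wᵀ).submatrix f id).det ^ 2 =
      F * (W * (Bᵀ * B) * Wᵀ).det := by
    rw [← e1]
    refine Finset.sum_congr rfl fun f _ => ?_
    rw [sq, ← Matrix.det_transpose]
    rfl
  calc F ^ 2 * (W * (Bᵀ * B) * Wᵀ).det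
      = ∑ f : ι → I, F * ((B * Wᵀ).submatrix f id).det ^ 2 := by
        rw [← Finset.mul_sum, e3]; ring
    _ ≤ ∑ f : ι → I, ∑ g : ι → J, ((2 * h) ^ 2) ^ Fintype.card ι :=
        Finset.sum_le_sum fun f _ => (hrow f).trans
          (Finset.sum_le_sum fun g _ => hB.sq_det_submatrix_le h0 f g)
    _ = _ := by
        simp [mul_pow, mul_assoc]

/-- If the first `j` eigenvalues of the Gram matrix of `B` are at least `l`, then `l` is bounded
in terms of the hereditary discrepancy. -/
theorem HasHerdiscLE.sq_mul_le_of_forall_le {k n j : ℕ} {B : Matrix (Fin k) (Fin n) ℝ} {h : ℝ}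
    (hB : HasHerdiscLE B h) (h0 : 0 ≤ h) (hj : j ≠ 0) (W : Matrix (Fin j) (Fin n) ℝ)
    (hW : W * Wᵀ = 1) (mu : Fin j → ℝ)
    (hdiag : W * (Bᵀ * B) * Wᵀ = Matrix.diagonal mu) {l : ℝ} (hl0 : 0 ≤ l)
    (hl : ∀ i, l ≤ mu i) :
    (j : ℝ) ^ 2 * l ≤ k * n * (2 * h) ^ 2 * Real.exp 1 ^ 2 := by
  have h1 := hB.det_compression_le h0 W hW
  rw [hdiag, Matrix.det_diagonal] at h1
  simp only [Fintype.card_fin] at h1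
  have h2 : l ^ j ≤ ∏ i, mu i := by
    have := Finset.prod_le_prod (s := Finset.univ) (fun _ _ => hl0) fun (i : Fin j) _ => hl i
    simpa using this
  have h3 : (j : ℝ) ^ j ≤ j.factorial * Real.exp 1 ^ j := by
    have := Real.pow_div_factorial_le_exp (j : ℝ) (Nat.cast_nonneg j) j
    rw [div_le_iff₀ (by positivity)] at this
    rw [← Real.exp_nat_mul, mul_one, mul_comm]
    exact this
  refine le_of_pow_le_pow_left₀ hj (by positivity) ?_
  calc ((j : ℝ) ^ 2 * l) ^ j = ((j : ℝ) ^ j) ^ 2 * l ^ j := by ring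
    _ ≤ (j.factorial * Real.exp 1 ^ j) ^ 2 * ∏ i, mu i := by gcongr
    _ = (Real.exp 1 ^ j) ^ 2 * (j.factorial ^ 2 * ∏ i, mu i) := by ring
    _ ≤ (Real.exp 1 ^ j) ^ 2 * (k * n * (2 * h) ^ 2) ^ j := by gcongr
    _ = _ := by ring

/-- Projecting away the leading eigenvectors leaves the tail of the spectrum. -/
theorem sum_sq_mul_one_sub_eq {k n j : ℕ} (B : Matrix (Fin k) (Fin n) ℝ) (hjn : j ≤ n)
    (mu : Fin n → ℝ) (η : Matrix (Fin n) (Fin n) ℝ) (hη : η * ηᵀ = 1)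
    (hdiag : η * (Bᵀ * B) * ηᵀ = Matrix.diagonal mu)
    (W : Matrix (Fin j) (Fin n) ℝ) (hW : W = η.submatrix (Fin.castLE hjn) id) :
    ∑ i, ∑ c, ((B * ((1 : Matrix (Fin n) (Fin n) ℝ) - Wᵀ * W)) i c) ^ 2 =
      ∑ t : Fin n, if (t : ℕ) < j then 0 else mu t := by
  have hη' : ηᵀ * η = 1 := mul_eq_one_comm.1 hη
  have htr : ∀ M : Matrix (Fin k) (Fin n) ℝ, ∑ i, ∑ c, M i c ^ 2 = (M * Mᵀ).trace := by
    intro M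
    simp [Matrix.trace, Matrix.mul_apply, sq]
  set D : Matrix (Fin n) (Fin n) ℝ :=
    Matrix.diagonal fun t => if (t : ℕ) < j then 0 else 1 with hD
  have hWW : Wᵀ * W = ηᵀ * (1 - D) * η := by
    have h1 : (1 - D : Matrix (Fin n) (Fin n) ℝ) =
        Matrix.diagonal fun t : Fin n => if (t : ℕ) < j then 1 else 0 := by
      rw [hD, ← Matrix.diagonal_one, Matrix.diagonal_sub]
      congr 1
      funext t
      split_ifs <;> simp
    ext a b
    rw [h1, hW, Matrix.mul_apply, Matrix.mul_apply]
    simp only [Matrix.mul_diagonal, Matrix.transpose_apply, Matrix.submatrix_apply, id,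
      mul_ite, mul_one, mul_zero, ite_mul, zero_mul]
    rw [← Finset.sum_filter]
    refine Finset.sum_bij (fun r _ => Fin.castLE hjn r) ?_ ?_ ?_ ?_
    · intro r _; simp
    · intro r _ r' _ hr; exact Fin.castLE_injective hjn hr
    · intro t ht; exact ⟨⟨t, by simpa using ht⟩, Finset.mem_univ _, rfl⟩
    · intro r _; rfl
  have hP : 1 - Wᵀ * W = ηᵀ * D * η := by
    rw [hWW, Matrix.mul_sub, Matrix.sub_mul, Matrix.mul_one, hη', sub_sub_cancel]
  have hDD : D * D = D := by
    rw [hD, Matrix.diagonal_mul_diagonal]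
    congr 1
    funext t
    split_ifs <;> simp
  rw [htr, hP]
  calc (B * (ηᵀ * D * η) * (B * (ηᵀ * D * η))ᵀ).trace
      = (B * ηᵀ * D * (η * ηᵀ) * (D * η * Bᵀ)).trace := by
        simp [Matrix.transpose_mul, Matrix.mul_assoc, hD]
    _ = ((B * ηᵀ) * (D * D) * (η * Bᵀ)).trace := by
        rw [hη]; simp only [Matrix.mul_one, Matrix.mul_assoc]
    _ = (D * (η * (Bᵀ * B) * ηᵀ)).trace := by
        rw [hDD, Matrix.mul_assoc, Matrix.trace_mul_comm]
        simp only [Matrix.mul_assoc]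
    _ = _ := by
        rw [hdiag, hD, Matrix.diagonal_mul_diagonal, Matrix.trace_diagonal]
        exact Finset.sum_congr rfl fun t _ => by split_ifs <;> simp

/-- let `A ∈ ℝ^{m×n}` with `m ≥ n ≥ 2`, let `B̄ ∈ ℝ^{k×n}` be obtained
from `A` by deleting rows, set `j = ⌈n/(8·log₂(8m/n))⌉ ≤ min k n`, and let `W` have
as rows orthonormal eigenvectors of `B̄ᵀB̄` corresponding to its `j` largest
eigenvalues. Then fewer than `k/2` rows of `B̄(I - WᵀW)` have Euclidean norm
exceeding `48e·log₂(8m/n)·herdisc(A)`. -/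
theorem stmt12 (m n k : ℕ) (hn : 2 ≤ n) (hm : n ≤ m)
    (A : Matrix (Fin m) (Fin n) ℝ)
    (f : Fin k → Fin m) (hf : StrictMono f)
    (Bbar : Matrix (Fin k) (Fin n) ℝ) (hB : Bbar = A.submatrix f id)
    (j : ℕ) (hj : j = ⌈(n : ℝ) / (8 * Real.logb 2 (8 * m / n))⌉₊)
    (hjk : j ≤ k) (hjn : j ≤ n)
    (mu : Fin n → ℝ) (η : Fin n → Fin n → ℝ)
    (hanti : ∀ i i' : Fin n, i ≤ i' → mu i' ≤ mu i)
    (hnonneg : ∀ i, 0 ≤ mu i)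
    (hortho : ∀ i i' : Fin n, (∑ t, η i t * η i' t) = if i = i' then 1 else 0)
    (heig : ∀ i, (Bbarᵀ * Bbar).mulVec (η i) = mu i • η i)
    (W : Matrix (Fin j) (Fin n) ℝ) (hW : ∀ r : Fin j, W r = η (Fin.castLE hjn r)) :
    2 * (Finset.univ.filter fun i : Fin k =>
        48 * Real.exp 1 * Real.logb 2 (8 * m / n) * herdisc A <
          Real.sqrt
            (∑ c, ((Bbar * ((1 : Matrix (Fin n) (Fin n) ℝ) - Wᵀ * W)) i c) ^ 2)).card
      < k := by
  subst hB
  set B := A.submatrix f id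
  set h := herdisc A with hh
  set L := Real.logb 2 (8 * m / n) with hL
  have h0 : 0 ≤ h := herdisc_nonneg A
  have hB : HasHerdiscLE B h := (hasHerdiscLE_herdisc A).submatrix f Function.injective_id
  have hn0 : (0 : ℝ) < n := by positivity
  have hL0 : 0 < L := by
    refine Real.logb_pos (by norm_num) ?_
    rw [lt_div_iff₀ hn0]
    have : (n : ℝ) ≤ m := by exact_mod_cast hm
    linarith
  have hj0 : 0 < j := by
    rw [hj]
    exact Nat.ceil_pos.2 (by positivity)
  have hjL : (n : ℝ) ≤ 8 * (j * L) := by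
    have := Nat.le_ceil ((n : ℝ) / (8 * L))
    rw [← hj, div_le_iff₀ (by positivity)] at this
    linarith
  let E : Matrix (Fin n) (Fin n) ℝ := Matrix.of η
  have hE : E * Eᵀ = 1 := by
    ext a b
    simpa [Matrix.mul_apply, Matrix.one_apply, E] using hortho a b
  have hEdiag : E * (Bᵀ * B) * Eᵀ = Matrix.diagonal mu := by
    have h1 : (Bᵀ * B) * Eᵀ = Eᵀ * Matrix.diagonal mu := by
      ext a b
      have := congrFun (heig b) a
      rw [Matrix.mul_diagonal, mul_comm]
      exact this
    rw [Matrix.mul_assoc, h1, ← Matrix.mul_assoc, hE, Matrix.one_mul]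
  have hWE : W = E.submatrix (Fin.castLE hjn) id := by
    ext r c
    rw [hW r]
    rfl
  have hcast := Fin.castLE_injective hjn
  have hWW : W * Wᵀ = 1 := by
    rw [← Matrix.submatrix_one (α := ℝ) (Fin.castLE hjn) hcast, ← hE, hWE]
    rfl
  have hWdiag : W * (Bᵀ * B) * Wᵀ = Matrix.diagonal (mu ∘ Fin.castLE hjn) := by
    rw [← Matrix.submatrix_diagonal _ _ hcast, ← hEdiag, hWE]
    rfl
  let l := mu ⟨j - 1, by omega⟩
  have hspec := hB.sq_mul_le_of_forall_le h0 hj0.ne' W hWW _ hWdiag (hnonneg _ : 0 ≤ l)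
    fun i => hanti _ _ (Fin.le_def.2 (by simp; omega))
  have htail : ∑ i, ∑ c, ((B * ((1 : Matrix (Fin n) (Fin n) ℝ) - Wᵀ * W)) i c) ^ 2 ≤ n * l := by
    rw [sum_sq_mul_one_sub_eq B hjn mu E hE hEdiag W hWE]
    calc _ ≤ ∑ t : Fin n, l := Finset.sum_le_sum fun t _ => by
          split_ifs with ht
          · exact hnonneg _
          · exact hanti _ _ (Fin.le_def.2 (by simp; omega))
      _ = n * l := by simp
  by_contra! hcard
  set S := Finset.univ.filter fun i : Fin k =>
    48 * Real.exp 1 * L * h <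
      Real.sqrt (∑ c, ((B * ((1 : Matrix (Fin n) (Fin n) ℝ) - Wᵀ * W)) i c) ^ 2) with hS
  have hSne : S.Nonempty := by
    rw [← Finset.card_pos]
    omega
  have hmass : S.card * (48 * Real.exp 1 * L * h) ^ 2 < n * l := by
    refine lt_of_lt_of_le ?_ htail
    calc S.card * (48 * Real.exp 1 * L * h) ^ 2
        = ∑ i ∈ S, (48 * Real.exp 1 * L * h) ^ 2 := by simp
      _ < ∑ i ∈ S, ∑ c, ((B * ((1 : Matrix (Fin n) (Fin n) ℝ) - Wᵀ * W)) i c) ^ 2 :=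
          Finset.sum_lt_sum_of_nonempty hSne fun i hi =>
            (Real.lt_sqrt (by positivity)).1 (Finset.mem_filter.1 hi).2
      _ ≤ _ := Finset.sum_le_sum_of_subset_of_nonneg (Finset.subset_univ _)
          fun i _ _ => Finset.sum_nonneg fun c _ => sq_nonneg _
  have hk : (k : ℝ) ≤ 2 * S.card := by exact_mod_cast hcard
  have hj2 : (0 : ℝ) < (j : ℝ) ^ 2 := by positivity
  have hup : (j : ℝ) ^ 2 * (k * (48 * Real.exp 1 * L * h) ^ 2) <
      2 * n * (k * n * (2 * h) ^ 2 * Real.exp 1 ^ 2) := calc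
    (j : ℝ) ^ 2 * (k * (48 * Real.exp 1 * L * h) ^ 2)
      ≤ (j : ℝ) ^ 2 * (2 * S.card * (48 * Real.exp 1 * L * h) ^ 2) := by gcongr
    _ = 2 * ((j : ℝ) ^ 2 * (S.card * (48 * Real.exp 1 * L * h) ^ 2)) := by ring
    _ < 2 * ((j : ℝ) ^ 2 * (n * l)) := by gcongr
    _ = 2 * n * ((j : ℝ) ^ 2 * l) := by ring
    _ ≤ _ := by gcongr
  have hlow : 2 * n * (k * n * (2 * h) ^ 2 * Real.exp 1 ^ 2) ≤
      (j : ℝ) ^ 2 * (k * (48 * Real.exp 1 * L * h) ^ 2) := calc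
    2 * n * (k * n * (2 * h) ^ 2 * Real.exp 1 ^ 2)
      = 8 * (k * h ^ 2 * Real.exp 1 ^ 2) * (n : ℝ) ^ 2 := by ring
    _ ≤ 8 * (k * h ^ 2 * Real.exp 1 ^ 2) * (8 * (j * L)) ^ 2 := by gcongr
    _ = 512 * (k * h ^ 2 * Real.exp 1 ^ 2 * (j * L) ^ 2) := by ring
    _ ≤ 2304 * (k * h ^ 2 * Real.exp 1 ^ 2 * (j * L) ^ 2) := by gcongr; norm_num
    _ = _ := by ring
  exact absurd hup (not_lt.2 hlow)
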